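/- Let n ≥ m ≥ 1 and let C be an n×n matrix whose entries in the first m rows are non-zero (finite) non-negative integers, whose last n−m rows are zero, and whose first column equals (d, d, …, d, 0, …, 0)ᵀ (with d in the first m entries), where d is the greatest common divisor of the non-zero entries of C. If C has rank 1 (as an integer matrix), then J_{nm} + C ∼_M J_{nm} + D, where D is the n×n matrix whose first m rows have every entry equal to d and whose last n−m rows are zero. -/

import Mathlib

/-- A directed graph as used in the theory of graph `C*`-algebras:
a type of vertices, a type of edges, and range and source maps. -/
structure CKGraph : Type 1 where
  V : Type
  E : Type
  r : E → V
  s : E → V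

namespace CKGraph

/-- An isomorphism of graphs: bijections of vertices and edges intertwining
the range and source maps. -/
structure Iso (G H : CKGraph) where
  vEquiv : G.V ≃ H.V
  eEquiv : G.E ≃ H.E
  map_r : ∀ e, H.r (eEquiv e) = vEquiv (G.r e)
  map_s : ∀ e, H.s (eEquiv e) = vEquiv (G.s e)

/-- A vertex is a source if it receives no edges. -/
def IsSource (G : CKGraph) (v : G.V) : Prop := ∀ e, G.r e ≠ v

/-- A vertex is a sink if it emits no edges. -/
def IsSink (G : CKGraph) (v : G.V) : Prop := ∀ e, G.s e ≠ v

/-- A vertex is an infinite emitter if it emits infinitely many edges. -/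
def IsInfiniteEmitter (G : CKGraph) (v : G.V) : Prop := {e | G.s e = v}.Infinite

/-- A vertex is regular if it is neither a sink nor an infinite emitter. -/
def Regular (G : CKGraph) (v : G.V) : Prop :=
  (∃ e, G.s e = v) ∧ {e | G.s e = v}.Finite

/-- There is a (nonempty) path from `u` to `v` in `G`. -/
inductive HasPath (G : CKGraph) : G.V → G.V → Prop
  | single (e : G.E) : HasPath G (G.s e) (G.r e)
  | cons (e : G.E) {v : G.V} : HasPath G (G.r e) v → HasPath G (G.s e) v

/-- `G.Geq u v` is the relation `u ≥ v`: `u = v` or there is a path from `u` to `v`. -/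
def Geq (G : CKGraph) (u v : G.V) : Prop := u = v ∨ G.HasPath u v

/-- There is a (nonempty) path from `u` to `v` all of whose vertices lie in `S`. -/
inductive HasPathIn (G : CKGraph) (S : Set G.V) : G.V → G.V → Prop
  | single (e : G.E) : G.s e ∈ S → G.r e ∈ S → HasPathIn G S (G.s e) (G.r e)
  | cons (e : G.E) {v : G.V} : G.s e ∈ S → HasPathIn G S (G.r e) v →
      HasPathIn G S (G.s e) v

/-- The nonempty list of edges `l` is a path from `u` to `v`. -/
def IsPathFromTo (G : CKGraph) (l : List G.E) (u v : G.V) : Prop :=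
  ∃ h : l ≠ [], l.Chain' (fun e f => G.r e = G.s f) ∧
    G.s (l.head h) = u ∧ G.r (l.getLast h) = v

/-- The list of edges `l` is a simple loop based at `v`: a loop at `v` such that the
range of every non-final edge is different from `v`. -/
def IsSimpleLoopAt (G : CKGraph) (v : G.V) (l : List G.E) : Prop :=
  G.IsPathFromTo l v v ∧ ∀ e ∈ l.dropLast, G.r e ≠ v

/-- A set of vertices is hereditary if it contains the range of every edge whose
source it contains. -/
def Hereditary (G : CKGraph) (H : Set G.V) : Prop := ∀ e, G.s e ∈ H → G.r e ∈ H

/-- A set of vertices is saturated if it contains every regular vertex all of whose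
emitted edges have range in the set. -/
def Saturated (G : CKGraph) (H : Set G.V) : Prop :=
  ∀ v, G.Regular v → (∀ e, G.s e = v → G.r e ∈ H) → v ∈ H

/-- Move (S): removing the (regular) source `v` together with all edges it emits. -/
def removeSource (G : CKGraph) (v : G.V) (hsrc : G.IsSource v) : CKGraph where
  V := {w : G.V // w ≠ v}
  E := {e : G.E // G.s e ≠ v}
  r e := ⟨G.r e.1, hsrc e.1⟩
  s e := ⟨G.s e.1, e.2⟩

/-- Move (R): the reduction at a vertex `u` that emits exactly one edge `f` with
`r f ≠ u` and receives only from the single vertex `v`. -/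
def reduce (G : CKGraph) (u : G.V) (f : G.E) (hf : G.s f = u) (hrf : G.r f ≠ u)
    (honly : ∀ e, G.s e = u → e = f) (v : G.V) (hin : ∀ e, G.r e = u → G.s e = v) :
    CKGraph where
  V := {w : G.V // w ≠ u}
  E := {e : G.E // G.r e ≠ u ∧ e ≠ f} ⊕ {e : G.E // G.r e = u}
  r x :=
    match x with
    | .inl e => ⟨G.r e.1, e.2.1⟩
    | .inr _ => ⟨G.r f, hrf⟩
  s x :=
    match x with
    | .inl e => ⟨G.s e.1, fun h => e.2.2 (honly e.1 h)⟩
    | .inr e => ⟨G.s e.1, by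
        intro h
        have h2 : G.r e.1 = u := e.2
        rw [honly e.1 h] at h2
        exact hrf h2⟩

/-- Move (O): the out-split of `G` at `v` according to the partition of `s⁻¹(v)`
into the fibres of `P`. -/
noncomputable def outSplit (G : CKGraph) (v : G.V) (n : ℕ)
    (P : {e : G.E // G.s e = v} → Fin n) : CKGraph :=
  letI := Classical.decEq G.V
  { V := {w : G.V // w ≠ v} ⊕ Fin n
    E := {e : G.E // G.r e ≠ v} ⊕ ({e : G.E // G.r e = v} × Fin n)
    r := fun x =>
      match x with
      | .inl e => Sum.inl ⟨G.r e.1, e.2⟩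
      | .inr p => Sum.inr p.2
    s := fun x =>
      match x with
      | .inl e =>
          if h : G.s e.1 = v then Sum.inr (P ⟨e.1, h⟩) else Sum.inl ⟨G.s e.1, h⟩
      | .inr p =>
          if h : G.s p.1.1 = v then Sum.inr (P ⟨p.1.1, h⟩)
          else Sum.inl ⟨G.s p.1.1, h⟩ }

/-- Move (I): the in-split of `G` at `v` according to the partition of `r⁻¹(v)`
into the fibres of `P`. -/
noncomputable def inSplit (G : CKGraph) (v : G.V) (n : ℕ)
    (P : {e : G.E // G.r e = v} → Fin n) : CKGraph :=
  letI := Classical.decEq G.V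
  { V := {w : G.V // w ≠ v} ⊕ Fin n
    E := {e : G.E // G.s e ≠ v} ⊕ ({e : G.E // G.s e = v} × Fin n)
    s := fun x =>
      match x with
      | .inl e => Sum.inl ⟨G.s e.1, e.2⟩
      | .inr p => Sum.inr p.2
    r := fun x =>
      match x with
      | .inl e =>
          if h : G.r e.1 = v then Sum.inr (P ⟨e.1, h⟩) else Sum.inl ⟨G.r e.1, h⟩
      | .inr p =>
          if h : G.r p.1.1 = v then Sum.inr (P ⟨p.1.1, h⟩)
          else Sum.inl ⟨G.r p.1.1, h⟩ }

/-- Move-equivalence: the smallest equivalence relation on graphs with finitely many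
vertices such that `G ∼ H` whenever `H` is obtained from `G`, up to graph
isomorphism, by one of the moves (S), (I), (O), (R). -/
inductive MoveEquiv : CKGraph → CKGraph → Prop
  | of_iso {G H : CKGraph} (hG : Finite G.V) (h : Nonempty (Iso G H)) : MoveEquiv G H
  | moveS {G : CKGraph} (hG : Finite G.V) (v : G.V) (hreg : G.Regular v)
      (hsrc : G.IsSource v) {H : CKGraph}
      (h : Nonempty (Iso H (G.removeSource v hsrc))) : MoveEquiv G H
  | moveR {G : CKGraph} (hG : Finite G.V) (u : G.V) (f : G.E) (hf : G.s f = u)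
      (hrf : G.r f ≠ u) (honly : ∀ e, G.s e = u → e = f) (v : G.V)
      (hin : ∀ e, G.r e = u → G.s e = v) {H : CKGraph}
      (h : Nonempty (Iso H (G.reduce u f hf hrf honly v hin))) : MoveEquiv G H
  | moveO {G : CKGraph} (hG : Finite G.V) (v : G.V) (hns : ¬ G.IsSink v) (n : ℕ)
      (P : {e : G.E // G.s e = v} → Fin n) (hsurj : Function.Surjective P)
      (hinf : ∀ i j : Fin n, {x : {e : G.E // G.s e = v} | P x = i}.Infinite →
        {x : {e : G.E // G.s e = v} | P x = j}.Infinite → i = j)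
      {H : CKGraph} (h : Nonempty (Iso H (G.outSplit v n P))) : MoveEquiv G H
  | moveI {G : CKGraph} (hG : Finite G.V) (v : G.V) (hreg : G.Regular v)
      (hns : ¬ G.IsSource v) (n : ℕ) (P : {e : G.E // G.r e = v} → Fin n)
      (hsurj : Function.Surjective P) {H : CKGraph}
      (h : Nonempty (Iso H (G.inSplit v n P))) : MoveEquiv G H
  | symm {G H : CKGraph} : MoveEquiv G H → MoveEquiv H G
  | trans {G H K : CKGraph} : MoveEquiv G H → MoveEquiv H K → MoveEquiv G K

/-- The graph obtained from `G` by collapsing a regular non-source vertex `v` that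
emits exactly one edge `f₀`, which is not a loop: delete `v`, `f₀` and all edges into
`v`, and add an edge `[e f₀]` from `s e` to `r f₀` for every edge `e` into `v`. -/
def collapseOne (G : CKGraph) (v : G.V) (f₀ : G.E) (hf : G.s f₀ = v)
    (honly : ∀ e, G.s e = v → e = f₀) (hr : G.r f₀ ≠ v) : CKGraph where
  V := {w : G.V // w ≠ v}
  E := {e : G.E // G.r e ≠ v ∧ e ≠ f₀} ⊕ {e : G.E // G.r e = v}
  r x :=
    match x with
    | .inl e => ⟨G.r e.1, e.2.1⟩
    | .inr _ => ⟨G.r f₀, hr⟩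
  s x :=
    match x with
    | .inl e => ⟨G.s e.1, fun h => e.2.2 (honly e.1 h)⟩
    | .inr e => ⟨G.s e.1, by
        intro h
        have h2 : G.r e.1 = v := e.2
        rw [honly e.1 h] at h2
        exact hr h2⟩

/-- The graph obtained from `G` by collapsing a regular vertex `v` which does not
support a loop of length one: delete `v` and all edges into or out of `v`, and add
an edge `[e f]` from `s e` to `r f` for every pair of edges `e, f` with
`r e = v = s f`. -/
def collapse (G : CKGraph) (v : G.V) (hnl : ∀ e, G.s e = v → G.r e ≠ v) :
    CKGraph where
  V := {w : G.V // w ≠ v}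
  E := {e : G.E // G.r e ≠ v ∧ G.s e ≠ v} ⊕
    ({e : G.E // G.r e = v} × {f : G.E // G.s f = v})
  s x :=
    match x with
    | .inl e => ⟨G.s e.1, e.2.2⟩
    | .inr p => ⟨G.s p.1.1, fun h => hnl p.1.1 h p.1.2⟩
  r x :=
    match x with
    | .inl e => ⟨G.r e.1, e.2.1⟩
    | .inr p => ⟨G.r p.2.1, fun h => hnl p.2.1 p.2.2 h⟩

/-- The graph obtained from `G` by adding countably infinitely many new edges,
each with source `u` and range `w`. -/
def addEdges (G : CKGraph) (u w : G.V) : CKGraph where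
  V := G.V
  E := G.E ⊕ ℕ
  r x := match x with | .inl e => G.r e | .inr _ => w
  s x := match x with | .inl e => G.s e | .inr _ => u

/-- The graph with exactly one vertex and no edges. -/
def singletonGraph : CKGraph where
  V := PUnit
  E := Empty
  r e := e.elim
  s e := e.elim

/-- The Cuntz splice of `G` at `v`: add two new vertices `u₁, u₂` and six new edges:
`v → u₁`, `u₁ → v`, a loop at `u₁`, `u₁ → u₂`, `u₂ → u₁`, and a loop at `u₂`. -/
def cuntzSplice (G : CKGraph) (v : G.V) : CKGraph where
  V := G.V ⊕ Fin 2
  E := G.E ⊕ Fin 6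
  s x :=
    match x with
    | .inl e => Sum.inl (G.s e)
    | .inr i => ![Sum.inl v, Sum.inr 0, Sum.inr 0, Sum.inr 0, Sum.inr 1, Sum.inr 1] i
  r x :=
    match x with
    | .inl e => Sum.inl (G.r e)
    | .inr i => ![Sum.inr 0, Sum.inl v, Sum.inr 0, Sum.inr 1, Sum.inr 0, Sum.inr 1] i

/-- The adjacency matrix (as an integer matrix) of a graph whose vertices are
enumerated by `Fin n`. -/
noncomputable def adjMatrix (G : CKGraph) {n : ℕ} (ρ : G.V ≃ Fin n) :
    Matrix (Fin n) (Fin n) ℤ :=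
  Matrix.of fun i j => (Nat.card {e : G.E // G.s e = ρ.symm i ∧ G.r e = ρ.symm j} : ℤ)

end CKGraph

/-- The graph of an `ℕ∞`-valued square matrix: it has exactly `A x y` edges from
`x` to `y`. -/
def graphOfMatrix {n : ℕ} (A : Matrix (Fin n) (Fin n) ℕ∞) : CKGraph where
  V := Fin n
  E := Σ x : Fin n, Σ y : Fin n, {k : ℕ // (k : ℕ∞) < A x y}
  s e := e.1
  r e := e.2.1

/-- Move-equivalence of (possibly differently sized) square matrices over `ℕ∞`. -/
def MatMoveEquiv {m n : ℕ} (A : Matrix (Fin m) (Fin m) ℕ∞)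
    (B : Matrix (Fin n) (Fin n) ℕ∞) : Prop :=
  CKGraph.MoveEquiv (graphOfMatrix A) (graphOfMatrix B)

/-- A square matrix is irreducible if any index connects to any other index through
a chain of non-zero entries. -/
def MatIrreducible {n : ℕ} {α : Type*} [Zero α] (A : Matrix (Fin n) (Fin n) α) :
    Prop :=
  ∀ i j : Fin n, ∃ (l : ℕ) (c : ℕ → Fin n), 1 ≤ l ∧ c 0 = i ∧ c l = j ∧
    ∀ t < l, A (c t) (c (t + 1)) ≠ 0

/-- `Jmat n m` is the `n × n` matrix whose top-left `m × m` block is the identity,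
whose other entries in the first `m` rows are `0`, and whose last `n - m` rows have
every entry equal to `∞`. -/
def Jmat (n m : ℕ) : Matrix (Fin n) (Fin n) ℕ∞ :=
  Matrix.of fun i j => if i.1 < m then (if i = j then 1 else 0) else ⊤

namespace CKGraph

open Cardinal

variable {X Y : Type}

/-- `G` has, up to the bijection `φ` of vertices, exactly `M x y` edges from `x` to `y`. -/
def Realizes (G : CKGraph) (M : X → X → Cardinal.{0}) : Prop :=
  ∃ φ : X ≃ G.V, ∀ x y, #{e : G.E // G.s e = φ x ∧ G.r e = φ y} = M x y

theorem Realizes.nonempty_iso {G H : CKGraph} {M : X → X → Cardinal.{0}}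
    (hG : G.Realizes M) (hH : H.Realizes M) : Nonempty (Iso G H) := by
  obtain ⟨φ, hφ⟩ := hG
  obtain ⟨ψ, hψ⟩ := hH
  have key : ∀ p : G.V × G.V, Nonempty ({e : G.E // (G.s e, G.r e) = p} ≃
      {e : H.E // (((φ.symm.trans ψ).prodCongr (φ.symm.trans ψ)).symm (H.s e, H.r e)) = p}) := by
    rintro ⟨x, y⟩
    rw [← Cardinal.eq]
    have h := (hφ (φ.symm x) (φ.symm y)).trans (hψ (φ.symm x) (φ.symm y)).symm
    simpa [Prod.ext_iff, Equiv.symm_apply_eq, ← Equiv.eq_symm_apply] using h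
  let F := fun p => (key p).some
  let eE : G.E ≃ H.E := (Equiv.sigmaFiberEquiv _).symm.trans
    ((Equiv.sigmaCongrRight F).trans (Equiv.sigmaFiberEquiv _))
  have h : ∀ e, ((φ.symm.trans ψ).prodCongr (φ.symm.trans ψ)).symm (H.s (eE e), H.r (eE e)) =
      (G.s e, G.r e) := fun e => (F (G.s e, G.r e) ⟨e, rfl⟩).2
  refine ⟨⟨φ.symm.trans ψ, eE, fun e => ?_, fun e => ?_⟩⟩
  · have h2 := congrArg Prod.snd ((Equiv.symm_apply_eq _).1 (h e))
    exact h2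
  · have h2 := congrArg Prod.fst ((Equiv.symm_apply_eq _).1 (h e))
    exact h2

theorem Realizes.finite [Finite X] {G : CKGraph} {M : X → X → Cardinal.{0}}
    (hG : G.Realizes M) : Finite G.V := by
  obtain ⟨φ, -⟩ := hG
  exact Finite.of_equiv X φ

/-- The graph with vertex set `X` and exactly `M x y` edges from `x` to `y`. -/
def ofCard (M : X → X → Cardinal.{0}) : CKGraph where
  V := X
  E := Σ x : X, Σ y : X, (M x y).out
  s e := e.1
  r e := e.2.1

theorem mk_sigma_sigma_fiber (F : X → X → Type) (x y : X) :
    #{e : Σ x : X, Σ y : X, F x y // e.1 = x ∧ e.2.1 = y} = #(F x y) := by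
  refine Cardinal.mk_congr ⟨fun e => cast (congrArg₂ F e.2.1 e.2.2) e.1.2.2,
    fun k => ⟨⟨x, y, k⟩, rfl, rfl⟩, ?_, ?_⟩
  · rintro ⟨⟨x, y, k⟩, rfl, rfl⟩
    rfl
  · intro k
    rfl

theorem mk_sigma_fiber (F : X → Type) (x : X) :
    #{e : Σ x : X, F x // e.1 = x} = #(F x) := by
  refine Cardinal.mk_congr ⟨fun e => e.2 ▸ e.1.2, fun k => ⟨⟨x, k⟩, rfl⟩, ?_, ?_⟩
  · rintro ⟨⟨x, k⟩, rfl⟩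
    rfl
  · intro k
    rfl

theorem mk_subtype_sum {α β : Type} (p : α ⊕ β → Prop) :
    #{e // p e} = #{a // p (.inl a)} + #{b // p (.inr b)} := by
  rw [Cardinal.mk_congr Equiv.subtypeSum, Cardinal.mk_sum, Cardinal.lift_id, Cardinal.lift_id]

theorem ofCard_realizes (M : X → X → Cardinal.{0}) : (ofCard M).Realizes M :=
  ⟨Equiv.refl X, fun x y =>
    (mk_sigma_sigma_fiber (fun x y => (M x y).out) x y).trans (Cardinal.mk_out _)⟩

theorem ofCard_refl [Finite X] (M : X → X → Cardinal.{0}) :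
    MoveEquiv (ofCard M) (ofCard M) :=
  .of_iso (ofCard_realizes M).finite ((ofCard_realizes M).nonempty_iso (ofCard_realizes M))

theorem Realizes.moveEquiv [Finite X] {G H : CKGraph} {M : X → X → Cardinal.{0}}
    (hG : G.Realizes M) (hH : H.Realizes M) : MoveEquiv G H :=
  .of_iso hG.finite (hG.nonempty_iso hH)

/-- The graph with all edges reversed. -/
def op (G : CKGraph) : CKGraph where
  V := G.V
  E := G.E
  r := G.s
  s := G.r

theorem Realizes.op {G : CKGraph} {M : X → X → Cardinal.{0}} (hG : G.Realizes M) :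
    G.op.Realizes (fun x y => M y x) := by
  obtain ⟨φ, hφ⟩ := hG
  refine ⟨φ, fun x y => ?_⟩
  refine Eq.trans ?_ (hφ y x)
  exact Cardinal.mk_congr (Equiv.subtypeEquivRight fun e => and_comm)

/-- The graph with `K a b` edges from `a` to `b`, together with `P b` distinguished further
edges from `u` to `b`. -/
def withRow (K : X → X → Cardinal.{0}) (u : X) (P : X → Cardinal.{0}) : CKGraph where
  V := X
  E := (Σ x : X, Σ y : X, (K x y).out) ⊕ (Σ y : X, (P y).out)
  s e := e.elim (fun e => e.1) (fun _ => u)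
  r e := e.elim (fun e => e.2.1) (fun e => e.1)

/-- The partition of the edges emitted by `u` into ordinary and distinguished ones. -/
def withRowPart (K : X → X → Cardinal.{0}) (u : X) (P : X → Cardinal.{0}) :
    {e : (withRow K u P).E // (withRow K u P).s e = u} → Fin 2 :=
  fun e => Sum.elim (fun _ => 0) (fun _ => 1) e.1

open Classical in
theorem mk_withRow_edges (K : X → X → Cardinal.{0}) (u : X) (P : X → Cardinal.{0}) (x y : X) :
    #{e : (withRow K u P).E // (withRow K u P).s e = x ∧ (withRow K u P).r e = y} =
      K x y + if x = u then P y else 0 := by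
  refine (mk_subtype_sum _).trans ?_
  congr 1
  · exact (mk_sigma_sigma_fiber (fun x y => (K x y).out) x y).trans (Cardinal.mk_out _)
  · split_ifs with h
    · subst h
      refine Eq.trans ?_ ((mk_sigma_fiber (fun y => (P y).out) y).trans (Cardinal.mk_out _))
      exact Cardinal.mk_congr (Equiv.subtypeEquivRight fun e => and_iff_right rfl)
    · rw [Cardinal.mk_eq_zero_iff]
      exact ⟨fun e => h e.2.1.symm⟩

open Classical in
theorem withRow_realizes (K : X → X → Cardinal.{0}) (u : X) (P : X → Cardinal.{0}) :
    (withRow K u P).Realizes (fun a b => K a b + if a = u then P b else 0) :=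
  ⟨Equiv.refl X, mk_withRow_edges K u P⟩

/-- The matrix of the out-split in which `u` is split off a new vertex `none` which emits
`P b` edges to each `b`. -/
def splitRow (K : X → X → Cardinal.{0}) (u : X) (P : X → Cardinal.{0}) :
    Option X → Option X → Cardinal.{0} :=
  fun x y => x.elim (P (y.getD u)) (fun a => K a (y.getD u))

open Classical in
/-- Vertices of a two-fold split at `u`. -/
noncomputable def splitEquiv (u : X) : Option X ≃ {w : X // w ≠ u} ⊕ Fin 2 where
  toFun x := x.elim (.inr 1) (fun a => if h : a = u then .inr 0 else .inl ⟨a, h⟩)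
  invFun x := x.elim (fun a => some a.1) (fun i => if i = 0 then some u else none)
  left_inv x := by
    rcases x with _ | a
    · simp
    · by_cases h : a = u <;> simp [h]
  right_inv x := by
    rcases x with a | i
    · simp [a.2]
    · fin_cases i <;> simp

theorem splitEquiv_none (u : X) : splitEquiv u none = .inr 1 := rfl

theorem splitEquiv_self (u : X) : splitEquiv u (some u) = .inr 0 := by
  simp [splitEquiv]

theorem splitEquiv_ne {u a : X} (h : a ≠ u) : splitEquiv u (some a) = .inl ⟨a, h⟩ := by
  simp [splitEquiv, h]

open Classical in
theorem outSplit_withRow_realizes (K : X → X → Cardinal.{0}) (u : X) (P : X → Cardinal.{0}) :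
    ((withRow K u P).outSplit u 2 (withRowPart K u P)).Realizes (splitRow K u P) := by
  let G := withRow K u P
  let H := G.outSplit u 2 (withRowPart K u P)
  let σ : G.E → Option X := Sum.elim (fun e => some e.1) (fun _ => none)
  let π : H.E → G.E := Sum.elim (fun e => e.1) (fun e => e.1.1)
  have hs : ∀ e : H.E, H.s e = splitEquiv u (σ (π e)) := by
    have key : ∀ e : G.E, (if h : G.s e = u then Sum.inr (withRowPart K u P ⟨e, h⟩)
        else Sum.inl ⟨G.s e, h⟩ : {w : X // w ≠ u} ⊕ Fin 2) = splitEquiv u (σ e) := by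
      rintro (e | e)
      · by_cases h : e.1 = u
        · refine (dif_pos h).trans ?_
          change Sum.inr 0 = splitEquiv u (some e.1)
          rw [h, splitEquiv_self]
        · exact (dif_neg h).trans (splitEquiv_ne h).symm
      · exact dif_pos rfl
    rintro (e | e)
    · exact key e.1
    · exact key e.1.1
  have hr : ∀ (e : H.E) (y : Option X), H.r e = splitEquiv u y → G.r (π e) = y.getD u := by
    rintro (e | e) (_ | y) h
    · exact absurd h Sum.inl_ne_inr
    · by_cases hy : y = u
      · subst hy
        rw [splitEquiv_self] at h
        exact absurd h Sum.inl_ne_inr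
      · rw [splitEquiv_ne hy] at h
        exact congrArg Subtype.val (Sum.inl.inj h)
    · exact e.1.2
    · by_cases hy : y = u
      · exact e.1.2.trans hy.symm
      · rw [splitEquiv_ne hy] at h
        exact absurd h Sum.inr_ne_inl
  have hinj : ∀ e e' : H.E, H.r e = H.r e' → π e = π e' → e = e' := by
    rintro (e | e) (e' | e') h h'
    · exact congrArg Sum.inl (Subtype.ext h')
    · exact absurd h Sum.inl_ne_inr
    · exact absurd h Sum.inr_ne_inl
    · exact congrArg Sum.inr (Prod.ext (Subtype.ext h') (Sum.inr.inj h))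
  have hsurj : ∀ (e : G.E) (y : Option X), G.r e = y.getD u →
      ∃ e' : H.E, π e' = e ∧ H.r e' = splitEquiv u y := by
    rintro e (_ | y) h
    · exact ⟨.inr (⟨e, h⟩, 1), rfl, rfl⟩
    · by_cases hy : y = u
      · subst hy
        exact ⟨.inr (⟨e, h⟩, 0), rfl, (splitEquiv_self _).symm⟩
      · refine ⟨.inl ⟨e, fun h' => hy (h.symm.trans h')⟩, rfl, ?_⟩
        rw [splitEquiv_ne hy]
        exact congrArg Sum.inl (Subtype.ext h)
  refine ⟨splitEquiv u, fun x y => ?_⟩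
  have hcard : #{e : H.E // H.s e = splitEquiv u x ∧ H.r e = splitEquiv u y} =
      #{e : G.E // σ e = x ∧ G.r e = y.getD u} := by
    refine Cardinal.mk_congr (Equiv.ofBijective
      (fun e => ⟨π e.1, (splitEquiv u).injective ((hs e.1).symm.trans e.2.1), hr _ _ e.2.2⟩)
      ⟨fun e e' h => ?_, fun e => ?_⟩)
    · exact Subtype.ext (hinj _ _ (e.2.2.trans e'.2.2.symm) (congrArg Subtype.val h))
    · obtain ⟨e', h1, h2⟩ := hsurj e.1 y e.2.2
      exact ⟨⟨e', by rw [hs, h1, e.2.1], h2⟩, Subtype.ext h1⟩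
  refine hcard.trans ((mk_subtype_sum _).trans ?_)
  rcases x with _ | a
  · have h0 : #{e : Σ x : X, Σ y : X, (K x y).out // σ (.inl e) = none ∧
        G.r (.inl e) = y.getD u} = 0 := by
      rw [Cardinal.mk_eq_zero_iff]
      exact ⟨fun e => Option.some_ne_none _ e.2.1⟩
    refine (congrArg (· + _) h0).trans ((zero_add _).trans ?_)
    refine Eq.trans ?_
      ((mk_sigma_fiber (fun y => (P y).out) (y.getD u)).trans (Cardinal.mk_out _))
    exact Cardinal.mk_congr (Equiv.subtypeEquivRight fun e => and_iff_right rfl)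
  · have h0 : #{e : Σ y : X, (P y).out // σ (.inr e) = some a ∧
        G.r (.inr e) = y.getD u} = 0 := by
      rw [Cardinal.mk_eq_zero_iff]
      exact ⟨fun e => Option.some_ne_none _ e.2.1.symm⟩
    refine (congrArg (_ + ·) h0).trans ((add_zero _).trans ?_)
    refine Eq.trans ?_ ((mk_sigma_sigma_fiber (fun x y => (K x y).out) a (y.getD u)).trans
      (Cardinal.mk_out _))
    exact Cardinal.mk_congr (Equiv.subtypeEquivRight fun e =>
      and_congr_left' (Option.some_inj))

theorem inSplit_eq_op (G : CKGraph) (v : G.V) (n : ℕ) (P : {e : G.E // G.r e = v} → Fin n) :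
    G.inSplit v n P = (G.op.outSplit v n P).op := by
  unfold inSplit outSplit op
  dsimp only
  congr 1
  · funext x
    rcases x with x | x <;> rfl
  · funext x
    rcases x with x | x <;> rfl

theorem nonempty_out {c : Cardinal.{0}} (h : c ≠ 0) : Nonempty c.out := by
  rwa [← Cardinal.mk_ne_zero_iff, Cardinal.mk_out]

theorem finite_out {c : Cardinal.{0}} (h : c < ℵ₀) : Finite c.out := by
  rwa [← Cardinal.lt_aleph0_iff_finite, Cardinal.mk_out]

theorem ite_one_zero_lt_aleph0 (p : Prop) [Decidable p] :
    (if p then 1 else 0 : Cardinal.{0}) < ℵ₀ := by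
  split_ifs
  · exact Cardinal.one_lt_aleph0
  · exact Cardinal.aleph0_pos

theorem withRowPart_surjective {K : X → X → Cardinal.{0}} {u : X} {P : X → Cardinal.{0}}
    (hK : ∃ b, K u b ≠ 0) (hP : ∃ b, P b ≠ 0) :
    Function.Surjective (withRowPart K u P) := by
  obtain ⟨b, hb⟩ := hK
  obtain ⟨c, hc⟩ := hP
  obtain ⟨k⟩ := nonempty_out hb
  obtain ⟨l⟩ := nonempty_out hc
  intro i
  fin_cases i
  · exact ⟨⟨.inl ⟨u, b, k⟩, rfl⟩, rfl⟩
  · exact ⟨⟨.inr ⟨c, l⟩, rfl⟩, rfl⟩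

open Classical in
theorem moveEquiv_splitRow [Finite X] (K : X → X → Cardinal.{0}) (u : X)
    (P : X → Cardinal.{0}) (hK : ∃ b, K u b ≠ 0) (hP : ∃ b, P b ≠ 0) (hfin : ∀ b, P b < ℵ₀) :
    MoveEquiv (ofCard fun a b => K a b + if a = u then P b else 0)
      (ofCard (splitRow K u P)) := by
  refine ((ofCard_realizes _).moveEquiv (withRow_realizes K u P)).trans ?_
  refine .moveO (withRow_realizes K u P).finite u ?_ 2 (withRowPart K u P)
    (withRowPart_surjective hK hP) ?_
    ((ofCard_realizes _).nonempty_iso (outSplit_withRow_realizes K u P))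
  · intro h
    obtain ⟨b, hb⟩ := hP
    obtain ⟨l⟩ := nonempty_out hb
    exact h (.inr ⟨b, l⟩) rfl
  · have h1 : ¬ {x | withRowPart K u P x = 1}.Infinite := by
      rw [Set.not_infinite]
      have := fun b => finite_out (hfin b)
      refine (Set.finite_range fun k : Σ y : X, (P y).out =>
        (⟨.inr k, rfl⟩ : {e : (withRow K u P).E // (withRow K u P).s e = u})).subset ?_
      rintro ⟨e | e, he⟩ h
      · exact absurd h (by simp [withRowPart])
      · exact ⟨e, rfl⟩
    intro i j hi hj
    fin_cases i <;> fin_cases j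
    · rfl
    · exact absurd hj h1
    · exact absurd hi h1
    · rfl

theorem regular_of_mk {G : CKGraph} [Finite G.V] {v : G.V}
    (h : ∃ w, #{e : G.E // G.s e = v ∧ G.r e = w} ≠ 0)
    (hfin : ∀ w, #{e : G.E // G.s e = v ∧ G.r e = w} < ℵ₀) : G.Regular v := by
  constructor
  · obtain ⟨w, hw⟩ := h
    obtain ⟨e⟩ := Cardinal.mk_ne_zero_iff.1 hw
    exact ⟨e.1, e.2.1⟩
  · have h : {e | G.s e = v} = ⋃ w, {e | G.s e = v ∧ G.r e = w} := by
      ext e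
      simp
    rw [h]
    exact Set.finite_iUnion fun w => Cardinal.lt_aleph0_iff_finite.1 (hfin w)

open Classical in
theorem moveEquiv_splitCol [Finite X] (K : X → X → Cardinal.{0}) (u : X)
    (P : X → Cardinal.{0}) (hK : ∃ a, K a u ≠ 0) (hP : ∃ a, P a ≠ 0)
    (hne : ∃ b, K u b ≠ 0) (hfin : ∀ b, K u b < ℵ₀) (hPu : P u = 0) :
    MoveEquiv (ofCard fun a b => K a b + if b = u then P a else 0)
      (ofCard fun x y => splitRow (fun a b => K b a) u P y x) := by
  have hG := (withRow_realizes (fun a b => K b a) u P).op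
  have hcount : ∀ b, #{e : (withRow (fun a b => K b a) u P).op.E //
      (withRow (fun a b => K b a) u P).op.s e = u ∧
      (withRow (fun a b => K b a) u P).op.r e = b} = K u b := by
    intro b
    refine (Cardinal.mk_congr (Equiv.subtypeEquivRight fun e => and_comm)).trans
      ((mk_withRow_edges (fun a b => K b a) u P b u).trans ?_)
    split_ifs with h <;> simp [hPu]
  refine ((ofCard_realizes _).moveEquiv hG).trans ?_
  have := hG.finite
  refine .moveI hG.finite u (regular_of_mk ?_ ?_) ?_ 2 (withRowPart (fun a b => K b a) u P)
    (withRowPart_surjective hK hP) ((ofCard_realizes _).nonempty_iso ?_)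
  · obtain ⟨b, hb⟩ := hne
    exact ⟨b, (hcount b).trans_ne hb⟩
  · exact fun b => (hcount b).trans_lt (hfin b)
  · intro h
    obtain ⟨b, hb⟩ := hP
    obtain ⟨l⟩ := nonempty_out hb
    exact h (.inr ⟨b, l⟩) rfl
  · refine Eq.mpr (congrArg (Realizes · _) (inSplit_eq_op _ _ _ _)) ?_
    exact (outSplit_withRow_realizes (fun a b => K b a) u P).op

/-- The matrix of the graph obtained by collapsing the vertex `none`. -/
def collapseNone (M : Option Y → Option Y → Cardinal.{0}) : Y → Y → Cardinal.{0} :=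
  fun a b => M (some a) (some b) + M (some a) none * M none (some b)

open Classical in
theorem moveEquiv_reduce [Finite Y] (M : Option Y → Option Y → Cardinal.{0}) (y₀ w₀ : Y)
    (hloop : M none none = 0) (hout : ∀ y, M none (some y) = if y = y₀ then 1 else 0)
    (hin : ∀ w, w ≠ w₀ → M (some w) none = 0) :
    MoveEquiv (ofCard M) (ofCard (collapseNone M)) := by
  have h1 : Nonempty (M none (some y₀)).out := nonempty_out (by simp [hout])
  obtain ⟨f⟩ := h1
  let G := ofCard M
  have honly : ∀ e : G.E, G.s e = none → e = ⟨none, some y₀, f⟩ := by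
    rintro ⟨x, y, k⟩ (rfl : x = none)
    rcases y with _ | y
    · rw [← Cardinal.mk_out (M none none)] at hloop
      exact absurd hloop (Cardinal.mk_ne_zero_iff.2 ⟨k⟩)
    · have hy : y = y₀ := by
        by_contra hy
        have h0 := hout y
        rw [if_neg hy, ← Cardinal.mk_out (M none (some y))] at h0
        exact absurd h0 (Cardinal.mk_ne_zero_iff.2 ⟨k⟩)
      subst hy
      have h0 := hout y
      rw [if_pos rfl, ← Cardinal.mk_out (M none (some y)), Cardinal.eq_one_iff_unique] at h0
      have := h0.1
      rw [Subsingleton.elim k f]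
  have hsrc : ∀ e : G.E, G.r e = none → G.s e = some w₀ := by
    rintro ⟨x, y, k⟩ (rfl : y = none)
    by_contra hx
    have h0 : M x none = 0 := by
      rcases x with _ | x
      · exact hloop
      · exact hin x fun h => hx (congrArg some h)
    rw [← Cardinal.mk_out (M x none)] at h0
    exact absurd h0 (Cardinal.mk_ne_zero_iff.2 ⟨k⟩)
  have hrf : G.r ⟨none, some y₀, f⟩ ≠ none := Option.some_ne_none y₀
  refine .moveR (ofCard_realizes M).finite none ⟨none, some y₀, f⟩ rfl hrf
    honly (some w₀) hsrc ((ofCard_realizes _).nonempty_iso ?_)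
  have hmk : ∀ x y, #{e : G.E // G.s e = x ∧ G.r e = y} = M x y := fun x y =>
    (mk_sigma_sigma_fiber (fun x y => (M x y).out) x y).trans (Cardinal.mk_out _)
  let φ : Y ≃ {w : Option Y // w ≠ none} :=
    ⟨fun y => ⟨some y, Option.some_ne_none y⟩, fun w => w.1.get (Option.ne_none_iff_isSome.1 w.2),
      fun y => rfl, fun w => Subtype.ext (Option.some_get _)⟩
  refine ⟨φ, fun a b => (mk_subtype_sum _).trans ?_⟩
  refine congrArg₂ (· + ·) ?_ ?_
  · refine Eq.trans ?_ (hmk (some a) (some b))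
    refine Cardinal.mk_congr ⟨fun e => ⟨e.1.1, congrArg Subtype.val e.2.1,
      congrArg Subtype.val e.2.2⟩, fun e => ⟨⟨e.1, ?_, ?_⟩, Subtype.ext e.2.1, Subtype.ext e.2.2⟩,
      fun e => rfl, fun e => rfl⟩
    · rw [e.2.2]
      exact Option.some_ne_none b
    · intro h
      have h2 := e.2.1
      rw [h] at h2
      exact Option.some_ne_none a h2.symm
  · rw [hout]
    split_ifs with hb
    · subst hb
      rw [mul_one]
      refine Eq.trans ?_ (hmk (some a) none)
      exact Cardinal.mk_congr ⟨fun e => ⟨e.1.1, congrArg Subtype.val e.2.1, e.1.2⟩,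
        fun e => ⟨⟨e.1, e.2.2⟩, Subtype.ext e.2.1, rfl⟩, fun e => rfl, fun e => rfl⟩
    · rw [mul_zero, Cardinal.mk_eq_zero_iff]
      exact ⟨fun e => hb (Option.some_injective _ (congrArg Subtype.val e.2.2)).symm⟩

open Classical in
theorem moveEquiv_collapse_aux [Finite Y] (y₀ : Y) (S : Finset Y) :
    ∀ M : Option Y → Option Y → Cardinal.{0}, M none none = 0 →
      (∀ y, M none (some y) = if y = y₀ then 1 else 0) →
      (∀ w, w ∉ S → M (some w) none = 0) →
      MoveEquiv (ofCard M) (ofCard (collapseNone M)) := by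
  induction S using Finset.induction_on with
  | empty =>
    intro M hloop hout hS
    exact moveEquiv_reduce M y₀ y₀ hloop hout fun w _ => hS w (Finset.notMem_empty w)
  | insert w S hw ih =>
    intro M hloop hout hS
    by_cases hMw : M (some w) none = 0
    · refine ih M hloop hout fun x hx => ?_
      by_cases hxw : x = w
      · rwa [hxw]
      · exact hS x (by simp [hxw, hx])
    by_cases hrest : ∀ x, x ≠ w → M (some x) none = 0
    · exact moveEquiv_reduce M y₀ w hloop hout hrest
    push Not at hrest
    obtain ⟨v, hvw, hv⟩ := hrest
    let P : Option Y → Cardinal.{0} := fun x => if x = some w then M (some w) none else 0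
    let K : Option Y → Option Y → Cardinal.{0} :=
      fun x y => if x = some w ∧ y = none then 0 else M x y
    have hKn : ∀ y, K none y = M none y := fun y => by simp [K]
    have hsplit : MoveEquiv (ofCard M)
        (ofCard fun x y => splitRow (fun a b => K b a) none P y x) := by
      have hcol := moveEquiv_splitCol K none P ⟨some v, ?_⟩ ⟨some w, ?_⟩ ⟨some y₀, ?_⟩ ?_ ?_
      · convert hcol using 2
        funext a b
        by_cases ha : a = some w <;> by_cases hb : b = none <;> simp [K, P, ha, hb]
      · simpa [K, hvw] using hv
      · simpa [P] using hMw
      · simp [hKn, hout]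
      · rintro (_ | b)
        · rw [hKn, hloop]
          exact Cardinal.aleph0_pos
        · rw [hKn, hout]
          exact ite_one_zero_lt_aleph0 _
      · simp [P]
    refine hsplit.trans ((moveEquiv_reduce _ (some y₀) (some w) ?_ ?_ ?_).trans ?_)
    · simp [splitRow, P]
    · rintro (_ | y)
      · simp [splitRow, hKn, hloop]
      · simp [splitRow, hKn, hout]
    · intro x hx
      simp [splitRow, P, hx]
    · have hfinal := ih (collapseNone fun x y => splitRow (fun a b => K b a) none P y x)
        ?_ ?_ ?_
      · convert hfinal using 2
        funext a b
        by_cases ha : a = w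
        · subst ha
          simp [collapseNone, splitRow, K, P, hloop]
        · simp [collapseNone, splitRow, K, P, ha, hloop]
      · simp [collapseNone, splitRow, K, P, hloop]
      · intro y
        simp [collapseNone, splitRow, K, P, hout]
      · intro x hx
        by_cases hxw : x = w
        · simp [collapseNone, splitRow, K, P, hxw, hloop]
        · simp [collapseNone, splitRow, K, P, hxw, hloop, hS x (by simp [hxw, hx])]

open Classical in
/-- Collapsing a vertex that emits exactly one edge, which is not a loop. -/
theorem moveEquiv_collapseNone [Finite Y] (M : Option Y → Option Y → Cardinal.{0}) (y₀ : Y)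
    (hloop : M none none = 0) (hout : ∀ y, M none (some y) = if y = y₀ then 1 else 0) :
    MoveEquiv (ofCard M) (ofCard (collapseNone M)) := by
  have := Fintype.ofFinite Y
  exact moveEquiv_collapse_aux y₀ Finset.univ M hloop hout
    fun w hw => absurd (Finset.mem_univ w) hw

open Classical in
/-- If there is an edge from `u` to `v ≠ u`, then column `u` of `M - 1` may be added to column
`v`. -/
theorem moveEquiv_addCol [Finite X] (K : X → X → Cardinal.{0}) {u v : X} (huv : u ≠ v)
    (hK : ∃ b, K u b ≠ 0) :
    MoveEquiv (ofCard fun a b => K a b + if a = u ∧ b = v then 1 else 0)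
      (ofCard fun a b => K a b + if b = v then K a u else 0) := by
  have h1 := moveEquiv_splitRow K u (fun b => if b = v then 1 else 0) hK ⟨v, by simp⟩
    (fun b => ite_one_zero_lt_aleph0 _)
  have h2 := moveEquiv_collapseNone (splitRow K u fun b => if b = v then 1 else 0) v
    (by simp [splitRow, huv]) (fun y => by simp [splitRow])
  convert h1.trans h2 using 2
  · funext a b
    by_cases ha : a = u <;> simp [ha]
  · funext a b
    simp [collapseNone, splitRow]

end CKGraph

open Cardinal CKGraph

theorem graphOfMatrix_realizes {n : ℕ} (A : Matrix (Fin n) (Fin n) ℕ∞) :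
    (graphOfMatrix A).Realizes (fun a b => #{k : ℕ // (k : ℕ∞) < A a b}) :=
  ⟨Equiv.refl _, mk_sigma_sigma_fiber _⟩

/-- Edge counts of the graph of `Jmat n m + C` when the first `m` rows of `C` are equal to `E`
and its other rows vanish. -/
noncomputable def rowCard (n m : ℕ) (E : Fin n → ℕ) : Fin n → Fin n → Cardinal.{0} :=
  fun a b => if a.1 < m then ((if a = b then 1 else 0) + E b : ℕ) else ℵ₀

theorem graphOfMatrix_realizes_rowCard {n m : ℕ} (C : Matrix (Fin n) (Fin n) ℕ) (E : Fin n → ℕ)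
    (hC : ∀ i j, C i j = if i.1 < m then E j else 0) :
    (graphOfMatrix (Jmat n m + C.map ((↑) : ℕ → ℕ∞))).Realizes (rowCard n m E) := by
  convert graphOfMatrix_realizes _ using 1
  funext a b
  by_cases ha : a.1 < m
  · have h : (Jmat n m + C.map ((↑) : ℕ → ℕ∞)) a b =
        (((if a = b then 1 else 0) + E b : ℕ) : ℕ∞) := by
      simp [Jmat, hC, ha]
    rw [h, rowCard, if_pos ha]
    simp only [Nat.cast_lt]
    rw [← Cardinal.mk_fin]
    exact Cardinal.mk_congr Fin.equivSubtype
  · have h : (Jmat n m + C.map ((↑) : ℕ → ℕ∞)) a b = ⊤ := by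
      simp [Jmat, ha]
    rw [h, rowCard, if_neg ha, ← Cardinal.mk_nat]
    exact Cardinal.mk_congr (Equiv.subtypeUnivEquiv fun k => ENat.natCast_lt_top k).symm

open Classical in
theorem moveEquiv_rowCard_update {n m : ℕ} (E : Fin n → ℕ) {u v : Fin n} (hu : u.1 < m)
    (huv : u ≠ v) (hv : E v ≠ 0) :
    MoveEquiv (ofCard (rowCard n m E))
      (ofCard (rowCard n m (Function.update E v (E v + E u)))) := by
  let K : Fin n → Fin n → Cardinal.{0} := fun a b =>
    if a = u ∧ b = v then ((E v - 1 : ℕ) : Cardinal.{0}) else rowCard n m E a b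
  have hKuu : K u u = ((1 + E u : ℕ) : Cardinal.{0}) := by
    simp [K, huv, rowCard, hu]
  have h := moveEquiv_addCol K huv ⟨u, by rw [hKuu]; exact_mod_cast by omega⟩
  convert h using 2
  · funext a b
    by_cases hab : a = u ∧ b = v
    · obtain ⟨rfl, rfl⟩ := hab
      simp only [K, rowCard, hu, huv, and_self, if_true, if_false]
      norm_cast
      omega
    · simp [K, hab]
  · funext a b
    by_cases hb : b = v
    · subst hb
      by_cases ha : a = u
      · subst ha
        rw [if_pos rfl, hKuu]
        simp only [K, rowCard, hu, huv, and_self, if_true, if_false, Function.update_self]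
        norm_cast
        omega
      · by_cases ham : a.1 < m
        · simp only [K, rowCard, ham, ha, false_and, if_true, if_false, Function.update_self]
          norm_cast
          omega
        · simp [K, rowCard, ham, ha]
    · simp [K, rowCard, hb]

theorem moveEquiv_rowCard_const {n m : ℕ} {d : ℕ} {u : Fin n} (hu : u.1 < m) (hd : 0 < d)
    (E : Fin n → ℕ) (hEu : E u = d) (hE : ∀ j, E j ≠ 0) (hdvd : ∀ j, d ∣ E j) :
    MoveEquiv (ofCard (rowCard n m E)) (ofCard (rowCard n m fun _ => d)) := by
  induction hs : ∑ j, E j using Nat.strong_induction_on generalizing E with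
  | _ s ih =>
    by_cases hall : ∀ j, E j = d
    · rw [funext hall]
      exact ofCard_refl _
    push Not at hall
    obtain ⟨v, hv⟩ := hall
    have huv : u ≠ v := by
      rintro rfl
      exact hv hEu
    have hle : d < E v :=
      lt_of_le_of_ne (Nat.le_of_dvd (Nat.pos_of_ne_zero (hE v)) (hdvd v)) (Ne.symm hv)
    let E' := Function.update E v (E v - d)
    have hE'v : E' v = E v - d := Function.update_self ..
    have hE'u : E' u = d := (Function.update_of_ne huv ..).trans hEu
    have hstep := moveEquiv_rowCard_update (m := m) E' hu huv (by omega)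
    have hupd : Function.update E' v (E' v + E' u) = E := by
      rw [hE'v, hE'u, Nat.sub_add_cancel hle.le]
      simp [E']
    rw [hupd] at hstep
    refine hstep.symm.trans (ih (∑ j, E' j) ?_ E' hE'u (fun j => ?_) (fun j => ?_) rfl)
    · rw [← hs]
      refine Finset.sum_lt_sum (fun j _ => ?_) ⟨v, Finset.mem_univ v, by omega⟩
      by_cases hj : j = v
      · subst hj
        omega
      · simp [E', hj]
    · by_cases hj : j = v
      · subst hj
        omega
      · simpa [E', hj] using hE j
    · by_cases hj : j = v
      · subst hj
        rw [hE'v]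
        exact Nat.dvd_sub (hdvd j) dvd_rfl
      · simpa [E', hj] using hdvd j

/-- The columns of an integer matrix of rank one are pairwise linearly dependent. -/
theorem Matrix.mul_eq_mul_of_rank_eq_one {n : ℕ} (A : Matrix (Fin n) (Fin n) ℤ)
    (hA : A.rank = 1) (i k j l : Fin n) : A i j * A k l = A k j * A i l := by
  by_contra hne
  have hli : LinearIndependent ℤ ![(⟨A.col j, by
      rw [Matrix.range_mulVecLin]; exact Submodule.subset_span ⟨j, rfl⟩⟩ :
        LinearMap.range A.mulVecLin), ⟨A.col l, by
      rw [Matrix.range_mulVecLin]; exact Submodule.subset_span ⟨l, rfl⟩⟩] := by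
    rw [LinearIndependent.pair_iff]
    intro s t hst
    have h := fun x => congrFun (congrArg Subtype.val hst) x
    have hi : s * A i j + t * A i l = 0 := by simpa using h i
    have hk : s * A k j + t * A k l = 0 := by simpa using h k
    have hdet : A i j * A k l - A k j * A i l ≠ 0 := sub_ne_zero.2 hne
    constructor
    · refine (mul_eq_zero.1 ?_).resolve_right hdet
      linear_combination A k l * hi - A i l * hk
    · refine (mul_eq_zero.1 ?_).resolve_right hdet
      linear_combination A i j * hk - A k j * hi
  have hcard := hli.fintype_card_le_finrank
  rw [← Matrix.rank, hA] at hcard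
  simp at hcard

/-- the rank one case of the standard form. -/
theorem stmt14 {n m : ℕ} (hm : 1 ≤ m) (hmn : m ≤ n) (d : ℕ)
    (C : Matrix (Fin n) (Fin n) ℕ)
    (hpos : ∀ i : Fin n, i.1 < m → ∀ j, C i j ≠ 0)
    (hzero : ∀ i : Fin n, m ≤ i.1 → ∀ j, C i j = 0)
    (hcol : ∀ i : Fin n, C i ⟨0, by omega⟩ = if i.1 < m then d else 0)
    (hdvd : ∀ i j, C i j ≠ 0 → d ∣ C i j)
    (hgreatest : ∀ d' : ℕ, (∀ i j, C i j ≠ 0 → d' ∣ C i j) → d' ∣ d)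
    (hrank : (C.map ((↑) : ℕ → ℤ)).rank = 1) :
    MatMoveEquiv (Jmat n m + C.map ((↑) : ℕ → ℕ∞))
      (Jmat n m + (Matrix.of fun i _ : Fin n =>
        if i.1 < m then d else 0).map ((↑) : ℕ → ℕ∞)) := by
  let u : Fin n := ⟨0, by omega⟩
  have hu : u.1 < m := by simp only [u]; omega
  have hCu : ∀ i : Fin n, i.1 < m → C i u = d := fun i hi => (hcol i).trans (if_pos hi)
  have hd : 0 < d := Nat.pos_of_ne_zero (hCu u hu ▸ hpos u hu u)
  have hrows : ∀ i j, C i j = if i.1 < m then C u j else 0 := by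
    intro i j
    split_ifs with hi
    · have h := Matrix.mul_eq_mul_of_rank_eq_one _ hrank i u j u
      simp only [Matrix.map_apply, hCu i hi, hCu u hu] at h
      exact_mod_cast mul_right_cancel₀ (Int.natCast_ne_zero.2 hd.ne') h
    · exact hzero i (not_lt.1 hi) j
  have hC := graphOfMatrix_realizes_rowCard C (C u) hrows
  have hD := graphOfMatrix_realizes_rowCard (m := m)
    (Matrix.of fun i _ : Fin n => if i.1 < m then d else 0) (fun _ => d) fun _ _ => rfl
  exact (hC.moveEquiv (ofCard_realizes _)).trans
    ((moveEquiv_rowCard_const hu hd (C u) (hCu u hu) (hpos u hu)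
      fun j => hdvd u j (hpos u hu j)).trans ((ofCard_realizes _).moveEquiv hD))
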